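/- Fix ρ > 0, 0 < η < ρ, a point m with |m| = η in ℝ^{k+1}, and let F(α) = ∫_{S^k(ρ)} ω(m,u)^α dS_u with ω = (ρ²−η²)/|m−u|². Then F is an entire function of α whose Taylor expansion at α = k/2 is F(α) = Σ_{m=0}^∞ ((α − k/2)^{2m}/(2m)!) ∫_{S^k(ρ)} ω^{k/2} (ln ω)^{2m} dS_u, with all even Taylor coefficients strictly positive and all odd Taylor coefficients zero. -/

import Mathlib

open MeasureTheory Metric Complex

/-- The surface measure on the sphere of radius `ρ` centered at the origin of
`ℝ^{k+1}`, realized as a measure on the ambient space. -/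
noncomputable def sphereSurfaceMeasure (k : ℕ) (ρ : ℝ) :
    Measure (EuclideanSpace ℝ (Fin (k + 1))) :=
  ENNReal.ofReal (ρ ^ k) •
    Measure.map (fun x : sphere (0 : EuclideanSpace ℝ (Fin (k + 1))) 1 => ρ • (x : EuclideanSpace ℝ (Fin (k + 1))))
      ((volume : Measure (EuclideanSpace ℝ (Fin (k + 1)))).toSphere)

open Module in
/-- Integration in polar coordinates of a product of a radial and an angular function. -/
theorem setIntegral_compl_zero_norm_mul_direction {E : Type*} [NormedAddCommGroup E]
    [NormedSpace ℝ E] [FiniteDimensional ℝ E] [MeasurableSpace E] [BorelSpace E]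
    (μ : Measure E) [μ.IsAddHaarMeasure] (h : ℝ → ℝ) (g : E → ℝ) :
    ∫ x in ({0}ᶜ : Set E), h ‖x‖ * g (‖x‖⁻¹ • x) ∂μ =
      (∫ v, g (v : E) ∂μ.toSphere) *
        ∫ r : Set.Ioi (0 : ℝ), h r ∂Measure.volumeIoiPow (finrank ℝ E - 1) := by
  rw [← integral_prod_mul (fun v : sphere (0 : E) 1 => g v) (fun r : Set.Ioi (0 : ℝ) => h r),
    ← (μ.measurePreserving_homeomorphUnitSphereProd).integral_comp
      (Homeomorph.measurableEmbedding _),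
    ← integral_subtype_comap (measurableSet_singleton _).compl]
  refine integral_congr_ae (.of_forall fun x => ?_)
  simp [mul_comm]

section SphereInversion

variable {E : Type*} [NormedAddCommGroup E] [InnerProductSpace ℝ E]

/-- The Poisson kernel of the unit ball at `a`, without its exponent. -/
noncomputable def unitPoisson (a v : E) : ℝ := (1 - ‖a‖ ^ 2) / ‖v - a‖ ^ 2

/-- The involution of the unit sphere that exchanges the end points of chords through `a`. -/
noncomputable def chordMap (a v : E) : E := a - unitPoisson a v • (v - a)

/-- The positively homogeneous extension of `chordMap a`. -/
noncomputable def coneChordMap (a x : E) : E := ‖x‖ • chordMap a (‖x‖⁻¹ • x)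

variable {a v x : E}

theorem sub_ne_zero_of_norm_lt_one {E : Type*} [NormedAddCommGroup E] {a v : E} (ha : ‖a‖ < 1)
    (hv : ‖v‖ = 1) : v - a ≠ 0 := by
  rw [sub_ne_zero]
  rintro rfl
  exact ha.ne hv

omit [InnerProductSpace ℝ E] in
theorem unitPoisson_pos (ha : ‖a‖ < 1) (hv : ‖v‖ = 1) : 0 < unitPoisson a v := by
  have h := norm_pos_iff.2 (sub_ne_zero_of_norm_lt_one ha hv)
  have : 0 < 1 - ‖a‖ ^ 2 := by nlinarith [norm_nonneg a]
  unfold unitPoisson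
  positivity

theorem chordMap_eq_reflection (ha : ‖a‖ < 1) (hv : ‖v‖ = 1) :
    chordMap a v = (ℝ ∙ (v - a))ᗮ.reflection v := by
  have h := norm_pos_iff.2 (sub_ne_zero_of_norm_lt_one ha hv)
  have hi : 2 * inner ℝ (v - a) v = ‖v - a‖ ^ 2 + (1 - ‖a‖ ^ 2) := by
    rw [norm_sub_sq_real, inner_sub_left, real_inner_self_eq_norm_sq, hv, real_inner_comm]
    ring
  have hi' : 2 * (inner ℝ (v - a) v / ‖v - a‖ ^ 2) = 1 + unitPoisson a v := by
    unfold unitPoisson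
    field_simp
    linarith
  rw [Submodule.reflection_orthogonal_apply, Submodule.reflection_singleton_apply]
  simp only [RCLike.ofReal_real_eq_id, id_eq]
  rw [← Nat.cast_smul_eq_nsmul ℝ, smul_smul, Nat.cast_ofNat, hi', chordMap, add_smul, one_smul]
  abel

theorem norm_chordMap (ha : ‖a‖ < 1) (hv : ‖v‖ = 1) : ‖chordMap a v‖ = 1 := by
  rw [chordMap_eq_reflection ha hv, LinearIsometryEquiv.norm_map, hv]

theorem unitPoisson_chordMap (ha : ‖a‖ < 1) (hv : ‖v‖ = 1) :
    unitPoisson a (chordMap a v) = (unitPoisson a v)⁻¹ := by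
  have h := norm_pos_iff.2 (sub_ne_zero_of_norm_lt_one ha hv)
  have hp : 0 < 1 - ‖a‖ ^ 2 := by nlinarith [norm_nonneg a]
  have : chordMap a v - a = -(unitPoisson a v • (v - a)) := by
    rw [chordMap]; abel
  rw [unitPoisson, this, norm_neg, norm_smul, Real.norm_eq_abs, mul_pow, sq_abs, unitPoisson]
  field_simp

theorem chordMap_chordMap (ha : ‖a‖ < 1) (hv : ‖v‖ = 1) : chordMap a (chordMap a v) = v := by
  have : chordMap a v - a = -(unitPoisson a v • (v - a)) := by
    rw [chordMap]; abel
  rw [chordMap, unitPoisson_chordMap ha hv, this, smul_neg, smul_smul,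
    inv_mul_cancel₀ (unitPoisson_pos ha hv).ne', one_smul]
  abel

theorem norm_direction {E : Type*} [NormedAddCommGroup E] [NormedSpace ℝ E] {x : E}
    (hx : x ≠ 0) : ‖‖x‖⁻¹ • x‖ = 1 :=
  norm_smul_inv_norm (𝕜 := ℝ) hx

theorem norm_coneChordMap (ha : ‖a‖ < 1) (hx : x ≠ 0) : ‖coneChordMap a x‖ = ‖x‖ := by
  rw [coneChordMap, norm_smul, norm_norm, norm_chordMap ha (norm_direction hx),
    mul_one]

theorem direction_coneChordMap (ha : ‖a‖ < 1) (hx : x ≠ 0) :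
    ‖coneChordMap a x‖⁻¹ • coneChordMap a x = chordMap a (‖x‖⁻¹ • x) := by
  rw [norm_coneChordMap ha hx, coneChordMap, smul_smul, inv_mul_cancel₀ (norm_ne_zero_iff.2 hx),
    one_smul]

theorem coneChordMap_coneChordMap (ha : ‖a‖ < 1) (hx : x ≠ 0) :
    coneChordMap a (coneChordMap a x) = x := by
  rw [coneChordMap, direction_coneChordMap ha hx, norm_coneChordMap ha hx,
    chordMap_chordMap ha (norm_direction hx), smul_smul,
    mul_inv_cancel₀ (norm_ne_zero_iff.2 hx), one_smul]

theorem coneChordMap_image (ha : ‖a‖ < 1) :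
    coneChordMap a '' ({0}ᶜ : Set E) = {0}ᶜ := by
  have key : ∀ x : E, x ≠ 0 → coneChordMap a x ≠ 0 := fun x hx => by
    rw [← norm_ne_zero_iff, norm_coneChordMap ha hx]; exact norm_ne_zero_iff.2 hx
  ext x
  constructor
  · rintro ⟨y, hy, rfl⟩
    exact key y hy
  · intro hx
    exact ⟨_, key x hx, coneChordMap_coneChordMap ha hx⟩

theorem hasFDerivAt_chordMap (ha : ‖a‖ < 1) (hv : ‖v‖ = 1) :
    HasFDerivAt (chordMap a)
      (-(unitPoisson a v • ((ℝ ∙ (v - a))ᗮ.reflection : E →L[ℝ] E))) v := by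
  have hp : 0 ≤ 1 - ‖a‖ ^ 2 := by nlinarith [norm_nonneg a]
  have h := (EuclideanGeometry.hasFDerivAt_inversion (c := a) (R := √(1 - ‖a‖ ^ 2))
    (sub_ne_zero.1 (sub_ne_zero_of_norm_lt_one ha hv))).const_sub (a + a)
  have e : ∀ w, (√(1 - ‖a‖ ^ 2) / dist w a) ^ 2 = unitPoisson a w := fun w => by
    rw [div_pow, Real.sq_sqrt hp, dist_eq_norm, unitPoisson]
  rw [e] at h
  refine h.congr_of_eventuallyEq (.of_forall fun w => ?_)
  simp only [EuclideanGeometry.inversion, e, chordMap, vsub_eq_sub, vadd_eq_add]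
  abel

theorem hasFDerivAt_norm_of_ne_zero (hx : x ≠ 0) :
    HasFDerivAt (fun y : E => ‖y‖) (‖x‖⁻¹ • innerSL ℝ x) x := by
  have h := (hasStrictFDerivAt_norm_sq x).hasFDerivAt.sqrt (by simpa using hx)
  simp only [Real.sqrt_sq (norm_nonneg _)] at h
  convert h using 1
  ext w
  have := norm_ne_zero_iff.2 hx
  simp
  field_simp

theorem hasFDerivAt_direction (hx : x ≠ 0) :
    HasFDerivAt (fun y : E => ‖y‖⁻¹ • y)
      (‖x‖⁻¹ • (ContinuousLinearMap.id ℝ E -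
        (innerSL ℝ (‖x‖⁻¹ • x)).smulRight (‖x‖⁻¹ • x))) x := by
  have hn := norm_ne_zero_iff.2 hx
  have h := ((hasDerivAt_inv hn).comp_hasFDerivAt x (hasFDerivAt_norm_of_ne_zero hx)).smul
    (hasFDerivAt_id x)
  refine h.congr_fderiv ?_
  ext w
  simp [smul_smul, sub_eq_add_neg]
  congr 1
  ring

/-- The derivative of `coneChordMap a` at a point of direction `v`. -/
noncomputable def coneChordDeriv (a v : E) : E →L[ℝ] E :=
  ((ℝ ∙ (v - a))ᗮ.reflection : E →L[ℝ] E) ∘L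
    (-(unitPoisson a v) • (ContinuousLinearMap.id ℝ E +
      (-(1 + (unitPoisson a v)⁻¹) • innerSL ℝ v).smulRight v))

theorem hasFDerivAt_coneChordMap (ha : ‖a‖ < 1) (hx : x ≠ 0) :
    HasFDerivAt (coneChordMap a) (coneChordDeriv a (‖x‖⁻¹ • x)) x := by
  have hn := norm_ne_zero_iff.2 hx
  have hv : ‖‖x‖⁻¹ • x‖ = 1 := norm_direction hx
  have h := (hasFDerivAt_norm_of_ne_zero hx).smul
    ((hasFDerivAt_chordMap ha hv).comp (f := fun y : E => ‖y‖⁻¹ • y) x (hasFDerivAt_direction hx))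
  refine h.congr_fderiv ?_
  ext w
  have hl := (unitPoisson_pos ha hv).ne'
  simp only [Function.comp_apply, chordMap_eq_reflection ha hv]
  simp only [coneChordDeriv]
  generalize unitPoisson a (‖x‖⁻¹ • x) = l at *
  generalize ((ℝ ∙ (‖x‖⁻¹ • x - a))ᗮ).reflection = S at *
  simp [smul_sub, smul_add, smul_smul]
  match_scalars
  · field_simp
  · field_simp
    ring

theorem abs_det_coneChordDeriv [FiniteDimensional ℝ E] (ha : ‖a‖ < 1) (hv : ‖v‖ = 1) :
    |(coneChordDeriv a v).det| = unitPoisson a v ^ (Module.finrank ℝ E - 1) := by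
  have hl := unitPoisson_pos ha hv
  have e : ((coneChordDeriv a v : E →L[ℝ] E) : E →ₗ[ℝ] E) =
      ((ℝ ∙ (v - a))ᗮ.reflection.toLinearMap) ∘ₗ (-(unitPoisson a v) • LinearMap.transvection
        (-(1 + (unitPoisson a v)⁻¹) • (innerSL ℝ v : E →ₗ[ℝ] ℝ)) v) := by
    ext w
    simp [coneChordDeriv, LinearMap.transvection]
    abel
  have hpos : 0 < Module.finrank ℝ E := by
    have : Nontrivial E := ⟨v, 0, by rintro rfl; simp at hv⟩
    exact Module.finrank_pos
  rw [ContinuousLinearMap.det, e, LinearMap.det_comp, Submodule.det_reflection,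
    LinearMap.det_smul, LinearMap.transvection.det]
  obtain ⟨n, hn⟩ := Nat.exists_eq_add_one_of_ne_zero hpos.ne'
  have hs : |1 + (-(1 + (unitPoisson a v)⁻¹) • (innerSL ℝ v : E →ₗ[ℝ] ℝ)) v| =
      (unitPoisson a v)⁻¹ := by
    rw [← abs_of_pos (inv_pos.2 hl), ← abs_neg]
    congr 1
    simp [hv, hl.le]
  rw [abs_mul, abs_mul, hs, hn]
  simp [abs_pow, abs_of_pos hl, pow_succ, hl.ne']

theorem integral_toSphere_comp_chordMap [FiniteDimensional ℝ E] [MeasurableSpace E]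
    [BorelSpace E] (μ : Measure E) [μ.IsAddHaarMeasure] (ha : ‖a‖ < 1) (g : E → ℝ) :
    ∫ v, unitPoisson a (v : E) ^ (Module.finrank ℝ E - 1) * g (chordMap a v) ∂μ.toSphere =
      ∫ v, g (v : E) ∂μ.toSphere := by
  set h : ℝ → ℝ := (Set.Iio 1).indicator 1 with hh
  have hc : ∫ r : Set.Ioi (0 : ℝ), h r ∂Measure.volumeIoiPow (Module.finrank ℝ E - 1) ≠ 0 := by
    have e : (fun r : Set.Ioi (0 : ℝ) => h r) =
        (Set.Iio (⟨1, Set.mem_Ioi.2 one_pos⟩ : Set.Ioi (0 : ℝ))).indicator 1 := by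
      ext r
      simp [hh, Set.indicator_apply, ← Subtype.coe_lt_coe]
    rw [e, integral_indicator_one measurableSet_Iio, Measure.real, Measure.volumeIoiPow_apply_Iio,
      ENNReal.toReal_ofReal (by positivity)]
    positivity
  refine mul_right_cancel₀ hc ?_
  rw [← setIntegral_compl_zero_norm_mul_direction μ h
      (fun v => unitPoisson a v ^ (Module.finrank ℝ E - 1) * g (chordMap a v)),
    ← setIntegral_compl_zero_norm_mul_direction]
  have hinj : Set.InjOn (coneChordMap a) ({0}ᶜ : Set E) := fun x hx y hy hxy => by
    rw [← coneChordMap_coneChordMap ha hx, hxy, coneChordMap_coneChordMap ha hy]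
  conv_rhs => rw [← coneChordMap_image ha]
  rw [integral_image_eq_integral_abs_det_fderiv_smul μ (measurableSet_singleton _).compl
    (fun x hx => (hasFDerivAt_coneChordMap ha hx).hasFDerivWithinAt) hinj]
  refine setIntegral_congr_fun (measurableSet_singleton _).compl fun x hx => ?_
  have hv : ‖‖x‖⁻¹ • x‖ = 1 := norm_direction hx
  have hd := direction_coneChordMap ha hx
  rw [norm_coneChordMap ha hx] at hd
  simp only [hd, norm_coneChordMap ha hx, abs_det_coneChordDeriv ha hv,
    smul_eq_mul]
  ring

end SphereInversion

theorem integral_sphereSurfaceMeasure {G : Type*} [NormedAddCommGroup G] [NormedSpace ℝ G]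
    (k : ℕ) {ρ : ℝ} (hρ : 0 < ρ) (f : EuclideanSpace ℝ (Fin (k + 1)) → G) :
    ∫ u, f u ∂sphereSurfaceMeasure k ρ =
      ρ ^ k • ∫ v, f (ρ • (v : EuclideanSpace ℝ (Fin (k + 1))))
        ∂(volume : Measure (EuclideanSpace ℝ (Fin (k + 1)))).toSphere := by
  have he : MeasurableEmbedding (fun x : sphere (0 : EuclideanSpace ℝ (Fin (k + 1))) 1 =>
      ρ • (x : EuclideanSpace ℝ (Fin (k + 1)))) :=
    (MeasurableEquiv.smul₀ ρ hρ.ne').measurableEmbedding.comp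
      (MeasurableEmbedding.subtype_coe isClosed_sphere.measurableSet)
  rw [sphereSurfaceMeasure, integral_smul_measure, he.integral_map,
    ENNReal.toReal_ofReal (by positivity)]

section SphereMoments

variable {E : Type*} [NormedAddCommGroup E] [InnerProductSpace ℝ E] {a : E}

omit [InnerProductSpace ℝ E] in
theorem continuous_unitPoisson_sphere (ha : ‖a‖ < 1) :
    Continuous fun v : sphere (0 : E) 1 => unitPoisson a (v : E) := by
  unfold unitPoisson
  refine Continuous.div (by fun_prop) (by fun_prop) fun v => ?_
  exact pow_ne_zero 2
    (norm_ne_zero_iff.2 (sub_ne_zero_of_norm_lt_one ha (norm_eq_of_mem_sphere v)))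

omit [InnerProductSpace ℝ E] in
theorem continuous_log_unitPoisson_sphere (ha : ‖a‖ < 1) :
    Continuous fun v : sphere (0 : E) 1 => Real.log (unitPoisson a (v : E)) :=
  (continuous_unitPoisson_sphere ha).log
    fun v => (unitPoisson_pos ha (norm_eq_of_mem_sphere v)).ne'

variable [FiniteDimensional ℝ E] [MeasurableSpace E] [BorelSpace E] (μ : Measure E)
  [μ.IsAddHaarMeasure]

theorem integrableExpSet_log_unitPoisson (ha : ‖a‖ < 1) :
    ProbabilityTheory.integrableExpSet
      (fun v : sphere (0 : E) 1 => Real.log (unitPoisson a (v : E))) μ.toSphere = Set.univ := by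
  refine Set.eq_univ_of_forall fun t => ?_
  have h := continuous_log_unitPoisson_sphere ha
  exact Continuous.integrable_of_hasCompactSupport (by fun_prop) (.of_compactSpace _)

/-- The logarithmic moments of odd order of the Poisson kernel, weighted by half the dimension of
the sphere, vanish. -/
theorem integral_unitPoisson_rpow_mul_log_pow_odd (ha : ‖a‖ < 1) {p : ℕ} (hp : Odd p) :
    ∫ v, unitPoisson a (v : E) ^ (((Module.finrank ℝ E - 1 : ℕ) : ℝ) / 2) *
      Real.log (unitPoisson a (v : E)) ^ p ∂μ.toSphere = 0 := by
  have h := integral_toSphere_comp_chordMap μ ha fun v =>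
    unitPoisson a v ^ (((Module.finrank ℝ E - 1 : ℕ) : ℝ) / 2) * Real.log (unitPoisson a v) ^ p
  rw [← self_eq_neg, ← integral_neg, ← h]
  refine integral_congr_ae (.of_forall fun v => ?_)
  have hv := norm_eq_of_mem_sphere v
  have hl := unitPoisson_pos ha hv
  simp only [unitPoisson_chordMap ha hv, Real.log_inv, hp.neg_pow]
  rw [Real.inv_rpow hl.le, ← Real.rpow_neg hl.le, mul_neg, mul_neg, ← mul_assoc,
    ← Real.rpow_natCast, ← Real.rpow_add hl]
  congr 3
  ring

theorem integral_unitPoisson_rpow_mul_log_pow_even_pos (ha : ‖a‖ < 1) (ha₀ : a ≠ 0) (s : ℝ) {p : ℕ}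
    (hp : Even p) :
    0 < ∫ v, unitPoisson a (v : E) ^ s * Real.log (unitPoisson a (v : E)) ^ p ∂μ.toSphere := by
  have hv := norm_direction ha₀
  have hpos := fun v : sphere (0 : E) 1 => unitPoisson_pos ha (norm_eq_of_mem_sphere v)
  refine Continuous.integral_pos_of_hasCompactSupport_nonneg_nonzero
    (x := ⟨‖a‖⁻¹ • a, by simpa using hv⟩) ?_ (.of_compactSpace _) ?_ ?_
  · exact ((continuous_unitPoisson_sphere ha).rpow_const fun v => .inl (hpos v).ne').mul
      ((continuous_log_unitPoisson_sphere ha).pow _)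
  · exact fun v => mul_nonneg (Real.rpow_nonneg (hpos v).le _) (hp.pow_nonneg _)
  · refine mul_ne_zero (Real.rpow_pos_of_pos (unitPoisson_pos ha hv) _).ne' (pow_ne_zero _ ?_)
    refine (Real.log_pos ?_).ne'
    have hn := norm_pos_iff.2 ha₀
    have e : ‖‖a‖⁻¹ • a - a‖ = 1 - ‖a‖ := by
      have : ‖a‖⁻¹ • a - a = (‖a‖⁻¹ - 1) • a := by rw [sub_smul, one_smul]
      rw [this, norm_smul, Real.norm_of_nonneg (sub_nonneg.2 ((one_le_inv₀ hn).2 ha.le)),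
        sub_mul, inv_mul_cancel₀ hn.ne', one_mul]
    rw [unitPoisson, e, one_lt_div (pow_pos (sub_pos.2 ha) 2)]
    nlinarith

theorem differentiable_complexMGF_log_unitPoisson (ha : ‖a‖ < 1) :
    Differentiable ℂ (ProbabilityTheory.complexMGF
      (fun v : sphere (0 : E) 1 => Real.log (unitPoisson a (v : E))) μ.toSphere) := by
  have h := ProbabilityTheory.differentiableOn_complexMGF
    (X := fun v : sphere (0 : E) 1 => Real.log (unitPoisson a (v : E))) (μ := μ.toSphere)
  simpa [integrableExpSet_log_unitPoisson μ ha, differentiableOn_univ] using h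

theorem hasSum_complexMGF_log_unitPoisson (ha : ‖a‖ < 1) (s : ℝ) (α : ℂ) :
    HasSum (fun p : ℕ => (α - s) ^ p / p.factorial *
        ((∫ v, unitPoisson a (v : E) ^ s * Real.log (unitPoisson a (v : E)) ^ p
          ∂μ.toSphere : ℝ) : ℂ))
      (ProbabilityTheory.complexMGF
        (fun v : sphere (0 : E) 1 => Real.log (unitPoisson a (v : E))) μ.toSphere α) := by
  have h := hasSum_taylorSeries_of_entire (differentiable_complexMGF_log_unitPoisson μ ha) (s : ℂ) α
  refine cast (congrArg (HasSum · _) (funext fun p => ?_)) h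
  symm
  rw [ProbabilityTheory.iteratedDeriv_complexMGF
    (by simp [integrableExpSet_log_unitPoisson μ ha]), ← integral_complex_ofReal]
  simp only [smul_eq_mul, div_eq_mul_inv]
  rw [mul_comm ((α - s) ^ p), mul_assoc]
  congr 3
  ext v
  rw [Real.rpow_def_of_pos (unitPoisson_pos ha (norm_eq_of_mem_sphere v))]
  push_cast
  ring_nf

end SphereMoments

/-- `F(α) = ∫_{S^k(ρ)} ω^α dS_u` is an entire function of `α` whose Taylor
expansion at `α = k/2` is `F(α) = Σ_m ((α−k/2)^{2m}/(2m)!) ∫ ω^{k/2}(ln ω)^{2m} dS`,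
with all even Taylor coefficients strictly positive (odd ones vanish). -/
theorem poisson_integral_entire_taylor (k : ℕ) (hk : 1 ≤ k) (ρ η : ℝ)
    (hρ : 0 < ρ) (hη : 0 < η) (hηρ : η < ρ)
    (m : EuclideanSpace ℝ (Fin (k + 1))) (hm : ‖m‖ = η)
    (ω : EuclideanSpace ℝ (Fin (k + 1)) → ℝ)
    (hω : ∀ u, ω u = (ρ ^ 2 - η ^ 2) / ‖m - u‖ ^ 2)
    (F : ℂ → ℂ)
    (hF : ∀ α : ℂ, F α = ∫ u, Complex.exp (α * Real.log (ω u)) ∂(sphereSurfaceMeasure k ρ)) :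
    Differentiable ℂ F
      ∧ (∀ α : ℂ, F α = ∑' n : ℕ,
          (α - (k : ℂ) / 2) ^ (2 * n) / (2 * n).factorial *
            ((∫ u, ω u ^ ((k : ℝ) / 2) * Real.log (ω u) ^ (2 * n)
                ∂(sphereSurfaceMeasure k ρ) : ℝ) : ℂ))
      ∧ (∀ n : ℕ,
          0 < ∫ u, ω u ^ ((k : ℝ) / 2) * Real.log (ω u) ^ (2 * n)
              ∂(sphereSurfaceMeasure k ρ)) := by
  set a : EuclideanSpace ℝ (Fin (k + 1)) := ρ⁻¹ • m with ha_def
  have ha : ‖a‖ = η / ρ := by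
    rw [ha_def, norm_smul, norm_inv, Real.norm_of_nonneg hρ.le, hm, inv_mul_eq_div]
  have ha₁ : ‖a‖ < 1 := by rwa [ha, div_lt_one hρ]
  have ha₀ : a ≠ 0 := by
    rw [← norm_pos_iff, ha]
    positivity
  have hωa : ∀ v : EuclideanSpace ℝ (Fin (k + 1)), ω (ρ • v) = unitPoisson a v := fun v => by
    have : m - ρ • v = -(ρ • (v - a)) := by
      rw [ha_def, smul_sub, smul_inv_smul₀ hρ.ne']
      abel
    rw [hω, this, norm_neg, norm_smul, Real.norm_of_nonneg hρ.le, unitPoisson, ha]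
    field_simp
  have hFσ : ∀ α, F α = (ρ : ℂ) ^ k * ProbabilityTheory.complexMGF
      (fun v : sphere (0 : EuclideanSpace ℝ (Fin (k + 1))) 1 =>
        Real.log (unitPoisson a (v : EuclideanSpace ℝ (Fin (k + 1)))))
      (volume : Measure (EuclideanSpace ℝ (Fin (k + 1)))).toSphere α := fun α => by
    rw [hF, integral_sphereSurfaceMeasure k hρ, ProbabilityTheory.complexMGF]
    simp only [hωa, Complex.real_smul, Complex.ofReal_pow]
  have hdim : Module.finrank ℝ (EuclideanSpace ℝ (Fin (k + 1))) - 1 = k := by simp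
  have hodd : ∀ p : ℕ, Odd p →
      ∫ v, unitPoisson a (v : EuclideanSpace ℝ (Fin (k + 1))) ^ ((k : ℝ) / 2) *
        Real.log (unitPoisson a (v : EuclideanSpace ℝ (Fin (k + 1)))) ^ p
          ∂(volume : Measure (EuclideanSpace ℝ (Fin (k + 1)))).toSphere = 0 := fun p hp => by
    have h := integral_unitPoisson_rpow_mul_log_pow_odd
      (volume : Measure (EuclideanSpace ℝ (Fin (k + 1)))) ha₁ hp
    rwa [hdim] at h
  refine ⟨?_, fun α => ?_, fun n => ?_⟩
  · rw [funext hFσ]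
    exact (differentiable_complexMGF_log_unitPoisson _ ha₁).const_mul _
  · have h := hasSum_complexMGF_log_unitPoisson
      (volume : Measure (EuclideanSpace ℝ (Fin (k + 1)))) ha₁ ((k : ℝ) / 2) α
    rw [← Function.Injective.hasSum_iff (g := fun n : ℕ => 2 * n)
      (mul_right_injective₀ two_ne_zero)] at h
    · rw [hFσ, ← h.tsum_eq, ← tsum_mul_left]
      refine tsum_congr fun n => ?_
      rw [integral_sphereSurfaceMeasure k hρ]
      simp only [hωa, smul_eq_mul, Function.comp_apply]
      push_cast
      ring
    · intro p hp
      have : Odd p := by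
        rw [← Nat.not_even_iff_odd]
        rintro ⟨n, rfl⟩
        exact hp ⟨n, two_mul n⟩
      rw [hodd p this, Complex.ofReal_zero, mul_zero]
  · rw [integral_sphereSurfaceMeasure k hρ]
    simp only [hωa, smul_eq_mul]
    exact mul_pos (pow_pos hρ k) (integral_unitPoisson_rpow_mul_log_pow_even_pos _ ha₁ ha₀ _
      (even_two_mul n))
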